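/- Let ν > 0 and c > 0. Then the function z ↦ (H_{−ν−c}(z))² / (H_{−ν}(z) · H_{−ν−2c}(z)) is strictly decreasing on ℝ, and for every z ∈ ℝ one has the sharp bounds 1 < (H_{−ν−c}(z))² / (H_{−ν}(z) H_{−ν−2c}(z)) < Γ(ν)Γ(ν+2c)/Γ(ν+c)². -/

import Mathlib

open MeasureTheory Set

/-- The Hermite function of negative order: `H_{-ν}(z)` for `ν > 0`. -/
noncomputable def HermiteNeg (ν z : ℝ) : ℝ :=
  (1 / Real.Gamma ν) * ∫ t in Ioi (0 : ℝ), Real.exp (-t ^ 2 - 2 * t * z) * t ^ (ν - 1)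

/-- The measure of the half line `(0, ∞)`. -/
local notation "μ₀" => (volume.restrict (Ioi (0 : ℝ)) : Measure ℝ)

/-- The integral of an almost everywhere positive function is positive. -/
lemma integral_pos_of_ae_pos {α : Type*} [MeasurableSpace α] {μ : Measure α} (hμ : μ ≠ 0)
    {f : α → ℝ} (hf : Integrable f μ) (hpos : ∀ᵐ x ∂μ, 0 < f x) : 0 < ∫ x, f x ∂μ := by
  rw [integral_pos_iff_support_of_nonneg_ae (hpos.mono fun x hx => hx.le) hf, pos_iff_ne_zero]
  intro h0
  have hzero : ∀ᵐ x ∂μ, f x = 0 := by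
    rw [ae_iff]
    exact h0
  refine hμ (ae_eq_bot.mp (Filter.eventually_false_iff_eq_bot.mp ?_))
  filter_upwards [hpos, hzero] with x hx hx0
  exact hx.ne' hx0

lemma restrict_Ioi_ne_zero : μ₀ ≠ 0 := by
  simp [Measure.restrict_eq_zero]

/-- Strict form of the Andréief (continuous Cauchy–Binet) inequality for `2 × 2` determinants. -/
lemma integral_mul_integral_lt {α : Type*} [MeasurableSpace α] {μ : Measure α} (hμ : μ ≠ 0)
    {f₁ f₂ g₁ g₂ : α → ℝ}
    (h₁₁ : Integrable (fun x => f₁ x * g₁ x) μ) (h₁₂ : Integrable (fun x => f₁ x * g₂ x) μ)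
    (h₂₁ : Integrable (fun x => f₂ x * g₁ x) μ) (h₂₂ : Integrable (fun x => f₂ x * g₂ x) μ)
    (hpos : ∀ᵐ x ∂μ, ∀ᵐ y ∂μ,
      0 < (f₁ x * f₂ y - f₂ x * f₁ y) * (g₁ x * g₂ y - g₂ x * g₁ y)) :
    (∫ x, f₁ x * g₂ x ∂μ) * (∫ x, f₂ x * g₁ x ∂μ) <
      (∫ x, f₁ x * g₁ x ∂μ) * (∫ x, f₂ x * g₂ x ∂μ) := by
  set I₁₁ := ∫ x, f₁ x * g₁ x ∂μ
  set I₁₂ := ∫ x, f₁ x * g₂ x ∂μ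
  set I₂₁ := ∫ x, f₂ x * g₁ x ∂μ
  set I₂₂ := ∫ x, f₂ x * g₂ x ∂μ
  have inner : ∀ᵐ x ∂μ, 0 < (f₁ x * g₁ x) * I₂₂ - (f₁ x * g₂ x) * I₂₁
      - (f₂ x * g₁ x) * I₁₂ + (f₂ x * g₂ x) * I₁₁ := by
    filter_upwards [hpos] with x hx
    have k₁ := h₂₂.const_mul (f₁ x * g₁ x)
    have k₂ := h₂₁.const_mul (f₁ x * g₂ x)
    have k₃ := h₁₂.const_mul (f₂ x * g₁ x)
    have k₄ := h₁₁.const_mul (f₂ x * g₂ x)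
    have hlt := integral_pos_of_ae_pos hμ (((k₁.sub k₂).sub k₃).add k₄) <| by
      filter_upwards [hx] with y hy
      simp only [Pi.add_apply, Pi.sub_apply]
      linarith
    rwa [integral_add' ((k₁.sub k₂).sub k₃) k₄, integral_sub' (k₁.sub k₂) k₃,
      integral_sub' k₁ k₂, integral_const_mul, integral_const_mul, integral_const_mul,
      integral_const_mul] at hlt
  have k₁ := h₁₁.mul_const I₂₂
  have k₂ := h₁₂.mul_const I₂₁
  have k₃ := h₂₁.mul_const I₁₂
  have k₄ := h₂₂.mul_const I₁₁
  have hlt := integral_pos_of_ae_pos hμ (((k₁.sub k₂).sub k₃).add k₄) inner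
  rw [integral_add' ((k₁.sub k₂).sub k₃) k₄, integral_sub' (k₁.sub k₂) k₃,
    integral_sub' k₁ k₂, integral_mul_const, integral_mul_const, integral_mul_const,
    integral_mul_const] at hlt
  linarith

lemma integral_Ioi_mul_comp_mul_left (f : ℝ → ℝ) {k : ℝ} (hk : 0 < k) :
    ∫ y in Ioi (0 : ℝ), k * f (k * y) = ∫ y in Ioi (0 : ℝ), f y := by
  rw [integral_const_mul, integral_comp_mul_left_Ioi f 0 hk, mul_zero, smul_eq_mul,
    mul_inv_cancel_left₀ hk.ne']

/-- Rescaling the second variable by a positive factor depending on the first one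
preserves integrability on the quadrant. -/
lemma integrable_skew_scale {K : ℝ × ℝ → ℝ} (hKm : Measurable K)
    (hK : Integrable K (Measure.prod μ₀ μ₀)) {k : ℝ → ℝ} (hkm : Measurable k)
    (hk : ∀ x, 0 < x → 0 < k x) :
    Integrable (fun p : ℝ × ℝ => k p.1 * K (p.1, k p.1 * p.2)) (Measure.prod μ₀ μ₀) := by
  have hmeas : Measurable (fun p : ℝ × ℝ => k p.1 * K (p.1, k p.1 * p.2)) := by fun_prop
  rw [integrable_prod_iff hmeas.aestronglyMeasurable]
  refine ⟨?_, ?_⟩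
  · filter_upwards [hK.prod_right_ae, ae_restrict_mem measurableSet_Ioi] with x hx hx0
    have := (integrableOn_Ioi_comp_mul_left_iff (fun y => K (x, y)) 0 (hk x hx0)).2
      (by rw [mul_zero]; exact hx)
    exact Integrable.const_mul this (k x)
  · refine hK.norm.integral_prod_left.congr ?_
    filter_upwards [ae_restrict_mem measurableSet_Ioi] with x hx0
    have hkx := hk x hx0
    rw [← integral_Ioi_mul_comp_mul_left (fun y => ‖K (x, y)‖) hkx]
    simp only [norm_mul, Real.norm_of_nonneg hkx.le]

/-- A product of two integrals over the half line in the coordinates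
`S = s + t` and `r = s / t`. -/
lemma integral_mul_integral_sum_ratio {u v : ℝ → ℝ} (hum : Measurable u) (hvm : Measurable v)
    (hu : IntegrableOn u (Ioi 0)) (hv : IntegrableOn v (Ioi 0)) :
    Integrable (fun p : ℝ × ℝ => (1 + p.2)⁻¹ * ((1 + p.2)⁻¹ * p.1 *
      (u ((1 + p.2)⁻¹ * p.1) * v ((1 + p.2)⁻¹ * p.1 * p.2)))) (Measure.prod μ₀ μ₀) ∧
    ∫ S in Ioi (0 : ℝ), ∫ r in Ioi (0 : ℝ), (1 + r)⁻¹ * ((1 + r)⁻¹ * S *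
      (u ((1 + r)⁻¹ * S) * v ((1 + r)⁻¹ * S * r))) =
    (∫ t in Ioi (0 : ℝ), u t) * ∫ s in Ioi (0 : ℝ), v s := by
  have hscaled : Integrable (fun p : ℝ × ℝ => p.1 * (u p.1 * v (p.1 * p.2))) (Measure.prod μ₀ μ₀) :=
    integrable_skew_scale (K := fun p => u p.1 * v p.2) (by fun_prop) (hu.mul_prod hv)
      measurable_id (fun x hx => hx)
  have hsum := integrable_skew_scale (K := fun p => p.2 * (u p.2 * v (p.2 * p.1)))
    (by fun_prop) hscaled.swap (k := fun r => (1 + r)⁻¹) (by fun_prop)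
    (fun x hx => by positivity)
  have hint := hsum.swap
  refine ⟨hint, ?_⟩
  rw [integral_integral_swap (f := fun S r => (1 + r)⁻¹ * ((1 + r)⁻¹ * S *
      (u ((1 + r)⁻¹ * S) * v ((1 + r)⁻¹ * S * r)))) hint]
  calc _ = ∫ r in Ioi (0 : ℝ), ∫ t in Ioi (0 : ℝ), t * (u t * v (t * r)) := by
        refine setIntegral_congr_fun measurableSet_Ioi fun r (hr : 0 < r) => ?_
        exact integral_Ioi_mul_comp_mul_left (fun t => t * (u t * v (t * r)))
          (by positivity : 0 < (1 + r)⁻¹)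
    _ = ∫ t in Ioi (0 : ℝ), ∫ r in Ioi (0 : ℝ), t * (u t * v (t * r)) :=
        (integral_integral_swap hscaled).symm
    _ = ∫ t in Ioi (0 : ℝ), u t * ∫ s in Ioi (0 : ℝ), v s := by
        refine setIntegral_congr_fun measurableSet_Ioi fun t (ht : 0 < t) => ?_
        simp only [← integral_const_mul]
        exact integral_Ioi_mul_comp_mul_left (fun s => u t * v s) ht
    _ = _ := integral_mul_const _ _

lemma sum_ratio_mul_rpow {S r : ℝ} (hS : 0 < S) (hr : 0 < r) (a b x y : ℝ) :
    (1 + r)⁻¹ * ((1 + r)⁻¹ * S * ((x * ((1 + r)⁻¹ * S) ^ (b - 1)) *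
      (y * ((1 + r)⁻¹ * S * r) ^ (a - 1)))) =
    S ^ (a + b - 1) * (x * y * (r ^ (a - 1) * (1 + r) ^ (-(a + b)))) := by
  have hr1 : 0 < 1 + r := by positivity
  rw [Real.mul_rpow (by positivity) hr.le, Real.mul_rpow (by positivity) hS.le,
    Real.mul_rpow (by positivity) hS.le, Real.inv_rpow hr1.le, Real.inv_rpow hr1.le,
    Real.rpow_neg hr1.le, show a + b - 1 = 1 + (a - 1) + (b - 1) by ring,
    show a + b = 1 + 1 + (a - 1) + (b - 1) by ring, Real.rpow_add hS, Real.rpow_add hS,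
    Real.rpow_add hr1, Real.rpow_add hr1, Real.rpow_add hr1, Real.rpow_one, Real.rpow_one]
  have h₁ := (Real.rpow_pos_of_pos hr1 (a - 1)).ne'
  have h₂ := (Real.rpow_pos_of_pos hr1 (b - 1)).ne'
  field_simp

/-- A product of two Mellin transforms in the coordinates `S = s + t` and `r = s / t`. -/
lemma mellin_mul_mellin {φ : ℝ → ℝ} (hφ : Measurable φ) {a b : ℝ}
    (ha : IntegrableOn (fun t => φ t * t ^ (a - 1)) (Ioi 0))
    (hb : IntegrableOn (fun t => φ t * t ^ (b - 1)) (Ioi 0)) :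
    Integrable (fun p : ℝ × ℝ => p.1 ^ (a + b - 1) * (φ ((1 + p.2)⁻¹ * p.1) *
      φ ((1 + p.2)⁻¹ * p.1 * p.2) * (p.2 ^ (a - 1) * (1 + p.2) ^ (-(a + b))))) (Measure.prod μ₀ μ₀) ∧
    ∫ S in Ioi (0 : ℝ), ∫ r in Ioi (0 : ℝ), S ^ (a + b - 1) * (φ ((1 + r)⁻¹ * S) *
      φ ((1 + r)⁻¹ * S * r) * (r ^ (a - 1) * (1 + r) ^ (-(a + b)))) =
    (∫ t in Ioi (0 : ℝ), φ t * t ^ (a - 1)) * ∫ t in Ioi (0 : ℝ), φ t * t ^ (b - 1) := by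
  obtain ⟨hint, heq⟩ := integral_mul_integral_sum_ratio (by fun_prop) (by fun_prop) hb ha
  refine ⟨hint.congr ?_, ?_⟩
  · rw [Measure.prod_restrict]
    filter_upwards [ae_restrict_mem (measurableSet_Ioi.prod measurableSet_Ioi)] with p hp
    exact sum_ratio_mul_rpow hp.1 hp.2 a b _ _
  · rw [mul_comm, ← heq]
    refine setIntegral_congr_fun measurableSet_Ioi fun S hS => ?_
    refine setIntegral_congr_fun measurableSet_Ioi fun r hr => ?_
    exact (sum_ratio_mul_rpow hS hr a b _ _).symm

/-- The Mellin transform of `exp (-t² - 2tz)`, i.e. `Γ(a) H_{-a}(z)`. -/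
noncomputable def hermiteIntegral (a z : ℝ) : ℝ :=
  ∫ t in Ioi (0 : ℝ), Real.exp (-t ^ 2 - 2 * t * z) * t ^ (a - 1)

/-- The normalized sum of squares `(s² + t²) / (s + t)²` as a function of `r = s / t`. -/
noncomputable def ratioSq (r : ℝ) : ℝ := 1 - 2 * r / (1 + r) ^ 2

/-- The beta-prime weight on ratios. -/
noncomputable def ratioWeight (m a r : ℝ) : ℝ := r ^ (a - 1) * (1 + r) ^ (-(2 * m))

/-- The integral over ratios at fixed sum `S` arising from the product
`hermiteIntegral a z * hermiteIntegral (2 * m - a) z`. -/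
noncomputable def ratioIntegral (m a S : ℝ) : ℝ :=
  ∫ r in Ioi (0 : ℝ), Real.exp (-(S ^ 2 * ratioSq r)) * ratioWeight m a r

lemma measurable_ratioSq : Measurable ratioSq := by
  unfold ratioSq
  fun_prop

lemma measurable_ratioWeight (m a : ℝ) : Measurable (ratioWeight m a) := by
  unfold ratioWeight
  fun_prop

lemma ratioWeight_pos (m a : ℝ) {r : ℝ} (hr : 0 < r) : 0 < ratioWeight m a r := by
  unfold ratioWeight
  positivity

lemma ratioSq_nonneg {r : ℝ} (hr : 0 < r) : 0 ≤ ratioSq r := by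
  have h : ratioSq r = (1 + r ^ 2) / (1 + r) ^ 2 := by
    unfold ratioSq
    field_simp
    ring
  rw [h]
  positivity

lemma integrableOn_hermite {a : ℝ} (ha : 0 < a) (z : ℝ) :
    IntegrableOn (fun t : ℝ => Real.exp (-t ^ 2 - 2 * t * z) * t ^ (a - 1)) (Ioi 0) := by
  have hdom := (integrableOn_rpow_mul_exp_neg_mul_sq (b := 1 / 2) (by norm_num)
    (s := a - 1) (by linarith)).const_mul (Real.exp (2 * z ^ 2))
  refine Integrable.mono' hdom (by fun_prop) ?_
  filter_upwards [ae_restrict_mem measurableSet_Ioi] with t ht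
  have ht' : 0 < t := ht
  rw [Real.norm_of_nonneg (by positivity)]
  calc Real.exp (-t ^ 2 - 2 * t * z) * t ^ (a - 1)
      ≤ Real.exp (2 * z ^ 2 + -(1 / 2) * t ^ 2) * t ^ (a - 1) := by
        gcongr
        nlinarith [sq_nonneg (t + 2 * z)]
    _ = _ := by rw [Real.exp_add]; ring

lemma hermiteIntegral_pos {a : ℝ} (ha : 0 < a) (z : ℝ) : 0 < hermiteIntegral a z := by
  refine integral_pos_of_ae_pos restrict_Ioi_ne_zero (integrableOn_hermite ha z) ?_
  filter_upwards [ae_restrict_mem measurableSet_Ioi] with t ht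
  have ht' : 0 < t := ht
  positivity

lemma integrable_ratioWeight_and_Gamma_mul {m a b : ℝ} (ha : 0 < a) (hb : 0 < b)
    (hab : a + b = 2 * m) :
    IntegrableOn (ratioWeight m a) (Ioi 0) ∧
      Real.Gamma a * Real.Gamma b = Real.Gamma (2 * m) * ratioIntegral m a 0 := by
  obtain ⟨hint, heq⟩ := mellin_mul_mellin (φ := fun t => Real.exp (-t)) (by fun_prop)
    (Real.GammaIntegral_convergent ha) (Real.GammaIntegral_convergent hb)
  have key : ∀ S r : ℝ, 0 < r → S ^ (a + b - 1) * (Real.exp (-((1 + r)⁻¹ * S)) *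
      Real.exp (-((1 + r)⁻¹ * S * r)) * (r ^ (a - 1) * (1 + r) ^ (-(a + b)))) =
      (Real.exp (-S) * S ^ (2 * m - 1)) * ratioWeight m a r := by
    intro S r hr
    have hr1 : (1 + r) ≠ 0 := by positivity
    rw [← Real.exp_add, hab, show -((1 + r)⁻¹ * S) + -((1 + r)⁻¹ * S * r) = -S by
      field_simp; ring, ratioWeight]
    ring
  constructor
  · have := ae_neBot.2 restrict_Ioi_ne_zero
    obtain ⟨S, hS, hS0⟩ := (hint.prod_right_ae.and
      (ae_restrict_mem measurableSet_Ioi)).exists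
    have hS0' : 0 < S := hS0
    have hne : Real.exp (-S) * S ^ (2 * m - 1) ≠ 0 := by positivity
    refine (integrable_const_mul_iff (isUnit_iff_ne_zero.2 hne) _).1 (hS.congr ?_)
    filter_upwards [ae_restrict_mem measurableSet_Ioi] with r hr
    exact key S r hr
  · rw [Real.Gamma_eq_integral ha, Real.Gamma_eq_integral hb, ← heq,
      Real.Gamma_eq_integral (by linarith : 0 < 2 * m), ← integral_mul_const]
    refine setIntegral_congr_fun measurableSet_Ioi fun S _ => ?_
    simp only [ratioIntegral, ← integral_const_mul]
    refine setIntegral_congr_fun measurableSet_Ioi fun r hr => ?_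
    simpa using key S r hr

lemma integrable_hermite_mul_and_hermite_mul {m a b : ℝ} (ha : 0 < a) (hb : 0 < b)
    (hab : a + b = 2 * m) (z : ℝ) :
    IntegrableOn (fun S => Real.exp (-(2 * z * S)) *
      (S ^ (2 * m - 1) * ratioIntegral m a S)) (Ioi 0) ∧
    hermiteIntegral a z * hermiteIntegral b z = ∫ S in Ioi (0 : ℝ),
      Real.exp (-(2 * z * S)) * (S ^ (2 * m - 1) * ratioIntegral m a S) := by
  obtain ⟨hint, heq⟩ := mellin_mul_mellin (φ := fun t => Real.exp (-t ^ 2 - 2 * t * z))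
    (by fun_prop) (integrableOn_hermite ha z) (integrableOn_hermite hb z)
  have key : ∀ S : ℝ, ∫ r in Ioi (0 : ℝ), S ^ (a + b - 1) *
      (Real.exp (-((1 + r)⁻¹ * S) ^ 2 - 2 * ((1 + r)⁻¹ * S) * z) *
      Real.exp (-((1 + r)⁻¹ * S * r) ^ 2 - 2 * ((1 + r)⁻¹ * S * r) * z) *
      (r ^ (a - 1) * (1 + r) ^ (-(a + b)))) =
      Real.exp (-(2 * z * S)) * (S ^ (2 * m - 1) * ratioIntegral m a S) := by
    intro S
    simp only [ratioIntegral, ← integral_const_mul]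
    refine setIntegral_congr_fun measurableSet_Ioi fun r (hr : 0 < r) => ?_
    have hr1 : (1 + r) ≠ 0 := by positivity
    have hexp : -((1 + r)⁻¹ * S) ^ 2 - 2 * ((1 + r)⁻¹ * S) * z +
        (-((1 + r)⁻¹ * S * r) ^ 2 - 2 * ((1 + r)⁻¹ * S * r) * z) =
        -(2 * z * S) + -(S ^ 2 * ratioSq r) := by
      unfold ratioSq
      field_simp
      ring
    rw [← Real.exp_add, hexp, Real.exp_add, hab, ratioWeight]
    ring
  constructor
  · refine hint.integral_prod_left.congr (Filter.Eventually.of_forall fun S => key S)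
  · rw [hermiteIntegral, hermiteIntegral, ← heq]
    exact integral_congr_ae (Filter.Eventually.of_forall fun S => key S)

lemma integrable_exp_mul_ratioWeight {m a : ℝ} (ha : 0 < a) (ham : a < 2 * m) (S : ℝ) :
    IntegrableOn (fun r => Real.exp (-(S ^ 2 * ratioSq r)) * ratioWeight m a r) (Ioi 0) := by
  have hdom := (integrable_ratioWeight_and_Gamma_mul (m := m) ha (sub_pos.2 ham) (by ring)).1
  have hm₁ := measurable_ratioSq
  have hm₂ := measurable_ratioWeight m a
  refine Integrable.mono' hdom (by fun_prop) ?_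
  filter_upwards [ae_restrict_mem measurableSet_Ioi] with r hr
  have hw := ratioWeight_pos m a hr
  have hq := ratioSq_nonneg hr
  rw [Real.norm_of_nonneg (by positivity)]
  exact mul_le_of_le_one_left hw.le (Real.exp_le_one_iff.2 (by nlinarith [sq_nonneg S]))

/-- The symmetrization of `ratioIntegral` under `r ↦ 1 / r`. -/
noncomputable def symRatioIntegral (m c S : ℝ) : ℝ :=
  (ratioIntegral m (m - c) S + ratioIntegral m (m + c) S) / 2

lemma ratioWeight_sub_add_eq (m c : ℝ) {r : ℝ} (hr : 0 < r) :
    (ratioWeight m (m - c) r + ratioWeight m (m + c) r) / 2 =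
      ratioWeight m m r * ((r ^ c + (r ^ c)⁻¹) / 2) := by
  unfold ratioWeight
  rw [show m - c - 1 = (m - 1) + -c by ring, show m + c - 1 = (m - 1) + c by ring,
    Real.rpow_add hr, Real.rpow_add hr, Real.rpow_neg hr.le]
  ring

lemma symRatioIntegral_eq {m c : ℝ} (hc : 0 < c) (hcm : c < m) (S : ℝ) :
    IntegrableOn (fun r => Real.exp (-(S ^ 2 * ratioSq r)) *
      (ratioWeight m m r * ((r ^ c + (r ^ c)⁻¹) / 2))) (Ioi 0) ∧
    symRatioIntegral m c S = ∫ r in Ioi (0 : ℝ), Real.exp (-(S ^ 2 * ratioSq r)) *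
      (ratioWeight m m r * ((r ^ c + (r ^ c)⁻¹) / 2)) := by
  have h₁ := integrable_exp_mul_ratioWeight (m := m) (a := m - c) (by linarith) (by linarith) S
  have h₂ := integrable_exp_mul_ratioWeight (m := m) (a := m + c) (by linarith) (by linarith) S
  have key : ∀ r ∈ Ioi (0 : ℝ), (Real.exp (-(S ^ 2 * ratioSq r)) * ratioWeight m (m - c) r +
      Real.exp (-(S ^ 2 * ratioSq r)) * ratioWeight m (m + c) r) / 2 =
      Real.exp (-(S ^ 2 * ratioSq r)) *
      (ratioWeight m m r * ((r ^ c + (r ^ c)⁻¹) / 2)) := by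
    intro r hr
    rw [← ratioWeight_sub_add_eq m c hr]
    ring
  constructor
  · refine ((Integrable.add h₁ h₂).div_const 2).congr ?_
    filter_upwards [ae_restrict_mem measurableSet_Ioi] with r hr
    exact key r hr
  · rw [symRatioIntegral, ratioIntegral, ratioIntegral, ← integral_add h₁ h₂,
      ← integral_div]
    exact setIntegral_congr_fun measurableSet_Ioi key

/-- Both `ratioSq` and `r ↦ r ^ c + r ^ (-c)` increase with `|log r|`. -/
lemma ratioSq_sub_mul_pos {c x y : ℝ} (hc : 0 < c) (hx : 0 < x) (hy : 0 < y) (hxy : y ≠ x)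
    (hxy' : y ≠ x⁻¹) :
    0 < (ratioSq y - ratioSq x) * ((y ^ c + (y ^ c)⁻¹) / 2 - (x ^ c + (x ^ c)⁻¹) / 2) := by
  have hxc : 0 < x ^ c := by positivity
  have hyc : 0 < y ^ c := by positivity
  have hprod : x * y ≠ 1 := fun h => hxy' (eq_inv_of_mul_eq_one_right h)
  have hq : ratioSq y - ratioSq x =
      ((y - x) * (x * y - 1)) * (2 / ((1 + x) ^ 2 * (1 + y) ^ 2)) := by
    unfold ratioSq
    field_simp
    ring
  have hw : (y ^ c + (y ^ c)⁻¹) / 2 - (x ^ c + (x ^ c)⁻¹) / 2 =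
      ((y ^ c - x ^ c) * ((x * y) ^ c - 1)) * (1 / (2 * x ^ c * y ^ c)) := by
    rw [Real.mul_rpow hx.le hy.le]
    field_simp
    ring
  have mono : ∀ {s t : ℝ}, 0 < s → 0 < t → s ≠ t → 0 < (s - t) * (s ^ c - t ^ c) := by
    intro s t hs ht hst
    rcases lt_or_gt_of_ne hst with h | h
    · exact mul_pos_of_neg_of_neg (sub_neg.2 h) (sub_neg.2 (Real.rpow_lt_rpow hs.le h hc))
    · exact mul_pos (sub_pos.2 h) (sub_pos.2 (Real.rpow_lt_rpow ht.le h hc))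
  have h₁ := mono hy hx hxy
  have h₂ := mono (mul_pos hx hy) one_pos hprod
  rw [Real.one_rpow] at h₂
  rw [hq, hw, show ∀ p q r s u v : ℝ, p * q * u * (r * s * v) = (p * r) * (q * s) * (u * v) by
    intros; ring]
  positivity

lemma ratioIntegral_mul_lt {m c S T : ℝ} (hc : 0 < c) (hcm : c < m) (hS : 0 ≤ S)
    (hST : S < T) :
    symRatioIntegral m c T * ratioIntegral m m S <
      ratioIntegral m m T * symRatioIntegral m c S := by
  obtain ⟨iT, eT⟩ := symRatioIntegral_eq hc hcm T
  obtain ⟨iS, eS⟩ := symRatioIntegral_eq hc hcm S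
  have jT := integrable_exp_mul_ratioWeight (m := m) (a := m) (by linarith) (by linarith) T
  have jS := integrable_exp_mul_ratioWeight (m := m) (a := m) (by linarith) (by linarith) S
  rw [eT, eS]
  refine integral_mul_integral_lt restrict_Ioi_ne_zero jT iT jS iS ?_
  filter_upwards [ae_restrict_mem measurableSet_Ioi] with x hx
  filter_upwards [ae_restrict_mem measurableSet_Ioi, Measure.ae_ne _ x,
    Measure.ae_ne _ x⁻¹] with y hy hyx hyx'
  have hpos := ratioSq_sub_mul_pos hc hx hy hyx hyx'
  have hwx := ratioWeight_pos m m hx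
  have hwy := ratioWeight_pos m m hy
  have hsq : S ^ 2 < T ^ 2 := by gcongr
  rw [← Real.exp_add, ← Real.exp_add]
  rcases pos_and_pos_or_neg_and_neg_of_mul_pos hpos with ⟨hq, hw⟩ | ⟨hq, hw⟩
  · refine mul_pos (sub_pos.2 (Real.exp_lt_exp.2 ?_)) ?_
    · nlinarith [mul_pos (sub_pos.2 hsq) hq]
    · nlinarith [mul_pos (mul_pos hwx hwy) hw]
  · refine mul_pos_of_neg_of_neg (sub_neg.2 (Real.exp_lt_exp.2 ?_)) ?_
    · nlinarith [mul_neg_of_pos_of_neg (sub_pos.2 hsq) hq]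
    · nlinarith [mul_neg_of_pos_of_neg (mul_pos hwx hwy) hw]

lemma ratioIntegral_lt_symRatioIntegral {m c : ℝ} (hc : 0 < c) (hcm : c < m) (S : ℝ) :
    ratioIntegral m m S < symRatioIntegral m c S := by
  obtain ⟨i, e⟩ := symRatioIntegral_eq hc hcm S
  have j := integrable_exp_mul_ratioWeight (m := m) (a := m) (by linarith) (by linarith) S
  rw [e, ratioIntegral, ← sub_pos, ← integral_sub i j]
  refine integral_pos_of_ae_pos restrict_Ioi_ne_zero (i.sub j) ?_
  filter_upwards [ae_restrict_mem measurableSet_Ioi, Measure.ae_ne _ 1] with r hr hr1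
  have hr0 : 0 < r := hr
  have hw := ratioWeight_pos m m hr
  have hrc : 0 < r ^ c := by positivity
  have hne : r ^ c ≠ 1 := fun h =>
    hr1 ((Real.rpow_left_inj hr0.le zero_le_one hc.ne').1 (by rw [h, Real.one_rpow]))
  have hgap : (r ^ c + (r ^ c)⁻¹) / 2 - 1 = (r ^ c - 1) ^ 2 / (2 * r ^ c) := by
    field_simp
    ring
  have hgap_pos : 0 < (r ^ c + (r ^ c)⁻¹) / 2 - 1 := by
    rw [hgap]
    have := sub_ne_zero.2 hne
    positivity
  have := mul_pos (mul_pos (Real.exp_pos (-(S ^ 2 * ratioSq r))) hw) hgap_pos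
  linarith

lemma hermiteIntegral_mul_eq_sym {m c : ℝ} (hc : 0 < c) (hcm : c < m) (z : ℝ) :
    IntegrableOn (fun S => Real.exp (-(2 * z * S)) *
      (S ^ (2 * m - 1) * symRatioIntegral m c S)) (Ioi 0) ∧
    hermiteIntegral (m - c) z * hermiteIntegral (m + c) z = ∫ S in Ioi (0 : ℝ),
      Real.exp (-(2 * z * S)) * (S ^ (2 * m - 1) * symRatioIntegral m c S) := by
  obtain ⟨i₁, e₁⟩ := integrable_hermite_mul_and_hermite_mul (m := m) (a := m - c) (b := m + c)
    (by linarith) (by linarith) (by ring) z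
  obtain ⟨i₂, e₂⟩ := integrable_hermite_mul_and_hermite_mul (m := m) (a := m + c) (b := m - c)
    (by linarith) (by linarith) (by ring) z
  have key : ∀ S : ℝ, (Real.exp (-(2 * z * S)) * (S ^ (2 * m - 1) * ratioIntegral m (m - c) S) +
      Real.exp (-(2 * z * S)) * (S ^ (2 * m - 1) * ratioIntegral m (m + c) S)) / 2 =
      Real.exp (-(2 * z * S)) * (S ^ (2 * m - 1) * symRatioIntegral m c S) := by
    intro S
    unfold symRatioIntegral
    ring
  simp only [← key]
  refine ⟨(Integrable.add i₁ i₂).div_const 2, ?_⟩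
  rw [integral_div, integral_add i₁ i₂, ← e₁, ← e₂]
  ring

lemma hermiteIntegral_mul_lt {m c z w : ℝ} (hc : 0 < c) (hcm : c < m) (hzw : z < w) :
    hermiteIntegral m w ^ 2 * (hermiteIntegral (m - c) z * hermiteIntegral (m + c) z) <
      hermiteIntegral m z ^ 2 * (hermiteIntegral (m - c) w * hermiteIntegral (m + c) w) := by
  have hm : 0 < m := hc.trans hcm
  obtain ⟨iz, ez⟩ := hermiteIntegral_mul_eq_sym hc hcm z
  obtain ⟨iw, ew⟩ := hermiteIntegral_mul_eq_sym hc hcm w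
  obtain ⟨jz, fz⟩ := integrable_hermite_mul_and_hermite_mul hm hm (two_mul m).symm z
  obtain ⟨jw, fw⟩ := integrable_hermite_mul_and_hermite_mul hm hm (two_mul m).symm w
  rw [sq, sq, ez, ew, fz, fw, mul_comm]
  refine integral_mul_integral_lt restrict_Ioi_ne_zero jz iz jw iw ?_
  filter_upwards [ae_restrict_mem measurableSet_Ioi] with S hS
  filter_upwards [ae_restrict_mem measurableSet_Ioi, Measure.ae_ne _ S] with T hT hTS
  have hS0 : 0 < S := hS
  have hT0 : 0 < T := hT
  have hpow : 0 < S ^ (2 * m - 1) * T ^ (2 * m - 1) := by positivity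
  rw [← Real.exp_add, ← Real.exp_add]
  rcases lt_or_gt_of_ne hTS with h | h
  · have hlt := ratioIntegral_mul_lt hc hcm hT0.le h
    refine mul_pos (sub_pos.2 (Real.exp_lt_exp.2 ?_)) ?_
    · nlinarith [mul_pos (sub_pos.2 hzw) (sub_pos.2 h)]
    · nlinarith [mul_pos hpow (sub_pos.2 hlt)]
  · have hlt := ratioIntegral_mul_lt hc hcm hS0.le h
    refine mul_pos_of_neg_of_neg (sub_neg.2 (Real.exp_lt_exp.2 ?_)) ?_
    · nlinarith [mul_pos (sub_pos.2 hzw) (sub_pos.2 h)]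
    · nlinarith [mul_pos hpow (sub_pos.2 hlt)]

lemma hermiteIntegral_sq_lt {m c : ℝ} (hc : 0 < c) (hcm : c < m) (z : ℝ) :
    hermiteIntegral m z ^ 2 < hermiteIntegral (m - c) z * hermiteIntegral (m + c) z := by
  have hm : 0 < m := hc.trans hcm
  obtain ⟨i, e⟩ := hermiteIntegral_mul_eq_sym hc hcm z
  obtain ⟨j, f⟩ := integrable_hermite_mul_and_hermite_mul hm hm (two_mul m).symm z
  rw [sq, e, f, ← sub_pos, ← integral_sub i j]
  refine integral_pos_of_ae_pos restrict_Ioi_ne_zero (i.sub j) ?_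
  filter_upwards [ae_restrict_mem measurableSet_Ioi] with S hS
  have hS0 : 0 < S := hS
  rw [sub_pos]
  gcongr
  exact ratioIntegral_lt_symRatioIntegral hc hcm S

lemma Gamma_sq_mul_hermiteIntegral_lt {m c : ℝ} (hc : 0 < c) (hcm : c < m) (z : ℝ) :
    Real.Gamma m ^ 2 * (hermiteIntegral (m - c) z * hermiteIntegral (m + c) z) <
      Real.Gamma (m - c) * Real.Gamma (m + c) * hermiteIntegral m z ^ 2 := by
  have hm : 0 < m := hc.trans hcm
  have hΓ : 0 < Real.Gamma (2 * m) := Real.Gamma_pos_of_pos (by linarith)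
  have g₀ := (integrable_ratioWeight_and_Gamma_mul hm hm (two_mul m).symm).2
  have g₁ := (integrable_ratioWeight_and_Gamma_mul (m := m) (a := m - c) (b := m + c)
    (by linarith) (by linarith) (by ring)).2
  have g₂ := (integrable_ratioWeight_and_Gamma_mul (m := m) (a := m + c) (b := m - c)
    (by linarith) (by linarith) (by ring)).2
  have g : Real.Gamma (m - c) * Real.Gamma (m + c) =
      Real.Gamma (2 * m) * symRatioIntegral m c 0 := by
    unfold symRatioIntegral
    linarith
  obtain ⟨i, e⟩ := hermiteIntegral_mul_eq_sym hc hcm z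
  obtain ⟨j, f⟩ := integrable_hermite_mul_and_hermite_mul hm hm (two_mul m).symm z
  rw [g, sq, sq, g₀, mul_assoc, mul_assoc]
  refine mul_lt_mul_of_pos_left ?_ hΓ
  have i' := i.const_mul (ratioIntegral m m 0)
  have j' := j.const_mul (symRatioIntegral m c 0)
  rw [e, f, ← sub_pos, ← integral_const_mul, ← integral_const_mul, ← integral_sub j' i']
  refine integral_pos_of_ae_pos restrict_Ioi_ne_zero (j'.sub i') ?_
  filter_upwards [ae_restrict_mem measurableSet_Ioi] with S hS
  have hS0 : 0 < S := hS
  have hlt := ratioIntegral_mul_lt hc hcm le_rfl hS0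
  have hk : 0 < Real.exp (-(2 * z * S)) * S ^ (2 * m - 1) := by positivity
  nlinarith [mul_pos hk (sub_pos.2 hlt)]

lemma HermiteNeg_ratio_eq {ν c : ℝ} (z : ℝ) :
    (HermiteNeg (ν + c) z) ^ 2 / (HermiteNeg ν z * HermiteNeg (ν + 2 * c) z) =
      (Real.Gamma ν * Real.Gamma (ν + 2 * c) / Real.Gamma (ν + c) ^ 2) *
      (hermiteIntegral (ν + c) z ^ 2 /
        (hermiteIntegral ν z * hermiteIntegral (ν + 2 * c) z)) := by
  have h (a : ℝ) : HermiteNeg a z = (Real.Gamma a)⁻¹ * hermiteIntegral a z := by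
    rw [HermiteNeg, hermiteIntegral, one_div]
  simp only [h, mul_pow, div_eq_mul_inv, mul_inv, inv_inv, inv_pow]
  ring

/-- Corollary: for `ν, c > 0`, `z ↦ H_{-ν-c}(z)² / (H_{-ν}(z) H_{-ν-2c}(z))` is
strictly decreasing on `ℝ` and satisfies the sharp fractional Turán bounds. -/
theorem Hermite_Turan (ν c : ℝ) (hν : 0 < ν) (hc : 0 < c) :
    StrictAnti (fun z => (HermiteNeg (ν + c) z) ^ 2
        / (HermiteNeg ν z * HermiteNeg (ν + 2 * c) z)) ∧
    ∀ z : ℝ,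
      1 < (HermiteNeg (ν + c) z) ^ 2 / (HermiteNeg ν z * HermiteNeg (ν + 2 * c) z) ∧
      (HermiteNeg (ν + c) z) ^ 2 / (HermiteNeg ν z * HermiteNeg (ν + 2 * c) z)
        < Real.Gamma ν * Real.Gamma (ν + 2 * c) / Real.Gamma (ν + c) ^ 2 := by
  have hνc : 0 < ν + c := by positivity
  have hν2c : 0 < ν + 2 * c := by positivity
  have hcm : c < ν + c := by linarith
  have hsub : ν + c - c = ν := by ring
  have hadd : ν + c + c = ν + 2 * c := by ring
  have hΓ : 0 < Real.Gamma ν * Real.Gamma (ν + 2 * c) / Real.Gamma (ν + c) ^ 2 := by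
    have h₀ := Real.Gamma_pos_of_pos hν
    have h₁ := Real.Gamma_pos_of_pos hνc
    have h₂ := Real.Gamma_pos_of_pos hν2c
    positivity
  have hden : ∀ z, 0 < hermiteIntegral ν z * hermiteIntegral (ν + 2 * c) z := fun z =>
    mul_pos (hermiteIntegral_pos hν z) (hermiteIntegral_pos hν2c z)
  simp only [HermiteNeg_ratio_eq]
  refine ⟨fun z w hzw => mul_lt_mul_of_pos_left ?_ hΓ, fun z => ⟨?_, ?_⟩⟩
  · have hlt := hermiteIntegral_mul_lt hc hcm hzw
    rw [hsub, hadd] at hlt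
    rwa [div_lt_div_iff₀ (hden w) (hden z)]
  · have hlt := Gamma_sq_mul_hermiteIntegral_lt hc hcm z
    rw [hsub, hadd] at hlt
    rwa [div_mul_div_comm, one_lt_div (mul_pos (pow_pos (Real.Gamma_pos_of_pos hνc) 2) (hden z))]
  · have hlt := hermiteIntegral_sq_lt hc hcm z
    rw [hsub, hadd] at hlt
    exact mul_lt_of_lt_one_right hΓ ((div_lt_one (hden z)).2 hlt)
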